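/- Let λ ∈ ℝ \ {−1, 0}, let K be a complex Hilbert space, let B be a positive operator on K with (|1−|λ||/2)·I < B < ((1+|λ|)/2)·I, and let T = (B ⊕ (−B)) + ((1+λ)/2)·I on H = K ⊕ K. Let 𝒯_λ = {(P, Q) : P, Q orthogonal projections on H with T = λP + Q}, and let W*(𝒯_λ) denote the von Neumann algebra generated by the set {P : (P,Q) ∈ 𝒯_λ} ∪ {Q : (P,Q) ∈ 𝒯_λ}. Then W*(𝒯_λ) equals the set of all operators on K ⊕ K whose four 2×2 block entries each commute with B, and the commutant of W*(𝒯_λ) equals {A ⊕ A : A belongs to the double commutant {B}''}. -/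

import Mathlib

noncomputable section

/-- `P` is an orthogonal projection: self-adjoint and idempotent. -/
def IsOrthoProj {H : Type*} [NormedAddCommGroup H] [InnerProductSpace ℂ H] [CompleteSpace H]
    (P : H →L[ℂ] H) : Prop :=
  IsSelfAdjoint P ∧ P * P = P

/-- Strict operator inequality `A < B`: `B − A` is positive and injective. -/
def OpLt {H : Type*} [NormedAddCommGroup H] [InnerProductSpace ℂ H] [CompleteSpace H]
    (A B : H →L[ℂ] H) : Prop :=
  (B - A).IsPositive ∧ Function.Injective (B - A)

/-- The block operator `[[A, B], [C, D]]` on the Hilbert space direct sum `K ⊕₂ K`. -/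
def blk {K : Type*} [NormedAddCommGroup K] [InnerProductSpace ℂ K]
    (A B C D : K →L[ℂ] K) : WithLp 2 (K × K) →L[ℂ] WithLp 2 (K × K) :=
  ((WithLp.prodContinuousLinearEquiv 2 ℂ K K).symm : K × K →L[ℂ] WithLp 2 (K × K)) ∘L
    ((A.coprod B).prod (C.coprod D)) ∘L
    ((WithLp.prodContinuousLinearEquiv 2 ℂ K K) : WithLp 2 (K × K) →L[ℂ] K × K)

variable {K : Type*} [NormedAddCommGroup K] [InnerProductSpace ℂ K] [CompleteSpace K]

/-- The set of pairs of projections `(P, Q)` with `T = λP + Q`. -/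
def pencilPairs {H : Type*} [NormedAddCommGroup H] [InnerProductSpace ℂ H] [CompleteSpace H]
    (lam : ℝ) (T : H →L[ℂ] H) : Set ((H →L[ℂ] H) × (H →L[ℂ] H)) :=
  {PQ | IsOrthoProj PQ.1 ∧ IsOrthoProj PQ.2 ∧ T = (lam : ℂ) • PQ.1 + PQ.2}

/-- The generating set of projections `{P : (P,Q) ∈ 𝒯_λ} ∪ {Q : (P,Q) ∈ 𝒯_λ}`. -/
def pencilGens {H : Type*} [NormedAddCommGroup H] [InnerProductSpace ℂ H] [CompleteSpace H]
    (lam : ℝ) (T : H →L[ℂ] H) : Set (H →L[ℂ] H) :=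
  Prod.fst '' pencilPairs lam T ∪ Prod.snd '' pencilPairs lam T

section Commutants

variable {A : Type*}

lemma mem_centralizer_singleton [Mul A] {a b : A} :
    b ∈ Set.centralizer {a} ↔ Commute a b := by
  simp [Set.mem_centralizer_iff, Commute, SemiconjBy]

lemma mem_bicommutant_singleton [Mul A] {a b : A} :
    b ∈ Set.centralizer (Set.centralizer {a}) ↔ ∀ c, Commute a c → Commute c b := by
  simp only [Set.mem_centralizer_iff (S := Set.centralizer {a}), mem_centralizer_singleton]
  rfl

/-- An element commuting with the unitaries of a closed star subalgebra commutes with all of it. -/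
lemma StarSubalgebra.commute_of_commute_unitary [CStarAlgebra A] (S : StarSubalgebra ℂ A)
    [IsClosed (S : Set A)] {x : A} (h : ∀ u ∈ unitary A, u ∈ S → Commute x u) {y : A}
    (hy : y ∈ S) : Commute x y := by
  have hspan : (⟨y, hy⟩ : S) ∈ Submodule.span ℂ (unitary S : Set S) := by
    rw [CStarAlgebra.span_unitary]; trivial
  refine Submodule.span_induction (p := fun (z : S) _ => Commute x (z : A)) ?_ ?_ ?_ ?_ hspan
  · intro u hu
    refine h u ?_ u.2
    rw [SetLike.mem_coe, Unitary.mem_iff] at hu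
    exact Unitary.mem_iff.2 ⟨congrArg Subtype.val hu.1, congrArg Subtype.val hu.2⟩
  · exact Commute.zero_right x
  · intro u v _ _ hu hv
    exact hu.add_right hv
  · intro c u _ hu
    exact hu.smul_right c

lemma mem_bicommutant_of_commute_unitary [CStarAlgebra A] {b x : A} (hb : IsSelfAdjoint b)
    (h : ∀ u ∈ unitary A, Commute b u → Commute x u) :
    x ∈ Set.centralizer (Set.centralizer {b}) := by
  rw [mem_bicommutant_singleton]
  intro c hc
  have hmem : ∀ z, z ∈ StarSubalgebra.centralizer ℂ {b} ↔ Commute b z := by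
    intro z
    simp [StarSubalgebra.mem_centralizer_iff, hb.star_eq, Commute, SemiconjBy]
  have : IsClosed (StarSubalgebra.centralizer ℂ {b} : Set A) := by
    rw [StarSubalgebra.coe_centralizer]
    exact Set.isClosed_centralizer _
  exact (StarSubalgebra.commute_of_commute_unitary (StarSubalgebra.centralizer ℂ {b})
    (fun u hu hu' => h u hu ((hmem u).1 hu')) ((hmem c).2 hc)).symm

lemma sqrt_mem_bicommutant [CStarAlgebra A] [PartialOrder A] [StarOrderedRing A] {b d : A}
    (hd : d ∈ Set.centralizer (Set.centralizer {b})) :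
    CFC.sqrt d ∈ Set.centralizer (Set.centralizer {b}) := by
  rw [mem_bicommutant_singleton] at hd ⊢
  exact fun c hc => ((hd c hc).symm.cfcₙ_nnreal _).symm

lemma commute_of_commute_mul_self [CStarAlgebra A] [PartialOrder A] [StarOrderedRing A] {b x : A}
    (hb : 0 ≤ b) (h : Commute (b * b) x) : Commute b x := by
  rw [← CFC.sqrt_mul_self b hb]
  exact h.cfcₙ_nnreal _

lemma IsSelfAdjoint.of_mul_eq_one [Monoid A] [StarMul A] {b c : A} (hb : IsSelfAdjoint b)
    (hbc : b * c = 1) : IsSelfAdjoint c := by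
  have h : star c * b = 1 := by simpa [hb.star_eq] using congrArg star hbc
  calc star c = star c * (b * c) := by rw [hbc, mul_one]
    _ = c := by rw [← mul_assoc, h, one_mul]

lemma Commute.right_of_mul_eq_one [Monoid A] {b c y : A} (hbc : b * c = 1) (hcb : c * b = 1)
    (h : Commute b y) : Commute y c :=
  calc y * c = c * b * (y * c) := by rw [hcb, one_mul]
    _ = c * (b * y) * c := by simp only [mul_assoc]
    _ = c * y * (b * c) := by rw [h.eq]; simp only [mul_assoc]
    _ = c * y := by rw [hbc, mul_one]

end Commutants

lemma OpLt.mono {B : K →L[ℂ] K} {c c' : ℝ} (h : OpLt ((c : ℂ) • (1 : K →L[ℂ] K)) B)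
    (hc : c' ≤ c) : OpLt ((c' : ℂ) • (1 : K →L[ℂ] K)) B := by
  rcases hc.eq_or_lt with rfl | hc
  · exact h
  have e : B - (c' : ℂ) • (1 : K →L[ℂ] K) =
      (B - (c : ℂ) • 1) + algebraMap ℝ (K →L[ℂ] K) (c - c') := by
    rw [Algebra.algebraMap_eq_smul_one, ← Complex.coe_smul]
    push_cast
    module
  have h0 : 0 ≤ B - (c : ℂ) • (1 : K →L[ℂ] K) :=
    (ContinuousLinearMap.nonneg_iff_isPositive _).2 h.1
  have hs : IsStrictlyPositive (B - (c' : ℂ) • (1 : K →L[ℂ] K)) := by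
    rw [e]
    exact (isStrictlyPositive_algebraMap (A := K →L[ℂ] K) (sub_pos.2 hc)).nonneg_add h0
  refine ⟨(ContinuousLinearMap.nonneg_iff_isPositive _).1 hs.nonneg, ?_⟩
  obtain ⟨u, hu⟩ := hs.isUnit
  intro x y hxy
  rw [← hu] at hxy
  have := congrArg (↑u⁻¹ : K →L[ℂ] K) hxy
  simpa [← mul_apply_eq_comp] using this

lemma OpLt.isUnit {B : K →L[ℂ] K} {c : ℝ} (h : OpLt ((c : ℂ) • (1 : K →L[ℂ] K)) B)
    (hc : 0 < c) : IsUnit B := by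
  refine CStarAlgebra.isUnit_of_le (algebraMap ℝ (K →L[ℂ] K) c) ?_
    (isStrictlyPositive_algebraMap hc)
  rw [Algebra.algebraMap_eq_smul_one, ← Complex.coe_smul]
  exact h.1

open scoped ComplexOrder in
/-- If `B` is self-adjoint and injective, positivity of `B D B` gives positivity of `D`. -/
lemma isPositive_of_conj_isPositive {B D : K →L[ℂ] K} (hB : IsSelfAdjoint B)
    (hinj : Function.Injective B) (hD : IsSelfAdjoint D) (h : (B * D * B).IsPositive) :
    D.IsPositive := by
  have hdense : DenseRange B := by
    have : (B.range).topologicalClosure = ⊤ := by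
      rw [Submodule.topologicalClosure_eq_top_iff, ContinuousLinearMap.orthogonal_range,
        hB.adjoint_eq]
      exact LinearMap.ker_eq_bot.2 hinj
    have h2 := Submodule.dense_iff_topologicalClosure_eq_top.2 this
    rwa [LinearMap.coe_range] at h2
  rw [ContinuousLinearMap.isPositive_iff']
  refine ⟨hD, fun y => ?_⟩
  refine hdense.induction_on (p := fun y => 0 ≤ inner ℂ (D y) y) y ?_ ?_
  · exact isClosed_Ici.preimage (by fun_prop : Continuous fun y => inner ℂ (D y) y)
  · intro x
    have := h.inner_nonneg_left x
    simp only [mul_apply_eq_comp] at this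
    rwa [show inner ℂ (B (D (B x))) x = inner ℂ (D (B x)) (B x) from hB.isSymmetric _ _] at this

/-- The diagonal entry `a` and off-diagonal entry `s` of a reflection `[[a, s], [s, -a]]`
coming from a pair of projections in the pencil. -/
lemma exists_reflection_entries {lam : ℝ} (hlam : lam ≠ -1 ∧ lam ≠ 0)
    {B : K →L[ℂ] K} (hBpos : B.IsPositive) (hBinj : Function.Injective B)
    (hB₁ : OpLt (((abs (1 - |lam|) / 2 : ℝ) : ℂ) • (1 : K →L[ℂ] K)) B)
    (hB₂ : OpLt B ((((1 + |lam|) / 2 : ℝ) : ℂ) • (1 : K →L[ℂ] K))) :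
    ∃ a s : K →L[ℂ] K, IsSelfAdjoint a ∧ IsSelfAdjoint s ∧ Function.Injective s ∧
      a ∈ Set.centralizer (Set.centralizer {B}) ∧ s ∈ Set.centralizer (Set.centralizer {B}) ∧
      a * a + s * s = 1 ∧
      (4 * lam : ℂ) • (B * a) = (4 : ℂ) • (B * B) + ((lam : ℂ) ^ 2 - 1) • 1 := by
  have hB := hBpos.isSelfAdjoint
  have hl : (lam : ℂ) ≠ 0 := by exact_mod_cast hlam.2
  have hBB : B ∈ Set.centralizer (Set.centralizer {B}) :=
    mem_bicommutant_singleton.2 fun c hc => hc.symm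
  obtain ⟨C, hC, hCB, hkC⟩ : ∃ C : K →L[ℂ] K, IsSelfAdjoint C ∧
      C ∈ Set.centralizer (Set.centralizer {B}) ∧
      ((lam : ℂ) ^ 2 - 1) • (B * C) = ((lam : ℂ) ^ 2 - 1) • 1 := by
    by_cases h : |lam| = 1
    · refine ⟨0, .zero _, Set.zero_mem_centralizer, ?_⟩
      have : (lam : ℂ) ^ 2 = 1 := by
        have : lam ^ 2 = 1 := by rw [← sq_abs, h, one_pow]
        exact_mod_cast this
      simp [this]
    · obtain ⟨u, hu⟩ := hB₁.isUnit
        (by have := abs_pos.2 (sub_ne_zero.2 (Ne.symm h)); positivity)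
      have h1 : B * (↑u⁻¹ : K →L[ℂ] K) = 1 := by rw [← hu]; exact u.mul_inv
      have h2 : (↑u⁻¹ : K →L[ℂ] K) * B = 1 := by rw [← hu]; exact u.inv_mul
      exact ⟨↑u⁻¹, hB.of_mul_eq_one h1,
        mem_bicommutant_singleton.2 fun c hc => hc.right_of_mul_eq_one h1 h2, by rw [h1]⟩
  set a : K →L[ℂ] K := ((lam⁻¹ : ℝ) : ℂ) • B + (((lam ^ 2 - 1) / (4 * lam) : ℝ) : ℂ) • C with ha
  have hasa : IsSelfAdjoint a :=
    (IsSelfAdjoint.smul (Complex.conj_ofReal _) hB).add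
      (IsSelfAdjoint.smul (Complex.conj_ofReal _) hC)
  have haB : a ∈ Set.centralizer (Set.centralizer {B}) := by
    rw [mem_bicommutant_singleton] at hBB hCB ⊢
    exact fun c hc => ((hBB c hc).smul_right _).add_right ((hCB c hc).smul_right _)
  have hBa : (4 * lam : ℂ) • (B * a) = (4 : ℂ) • (B * B) + ((lam : ℂ) ^ 2 - 1) • 1 := by
    rw [← hkC, ha]
    simp only [mul_add, mul_smul_comm, smul_add, smul_smul]
    push_cast
    congr 2 <;> field_simp
  have haBc : Commute B a := mem_bicommutant_singleton.1 haB B rfl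
  set D : K →L[ℂ] K := 1 - a * a with hD
  have hDB : D ∈ Set.centralizer (Set.centralizer {B}) := by
    rw [mem_bicommutant_singleton] at haB ⊢
    exact fun c hc => (Commute.one_right c).sub_right ((haB c hc).mul_right (haB c hc))
  have hDBc : Commute B D := mem_bicommutant_singleton.1 hDB B rfl
  have hDsa : IsSelfAdjoint D := (IsSelfAdjoint.one _).sub (by
    simpa [hasa.star_eq] using IsSelfAdjoint.star_mul_self a)
  set μ : ℝ := |lam| with hμ
  have hμ0 : 0 < μ := abs_pos.2 hlam.2
  have hsq : (lam : ℂ) ^ 2 = (μ : ℂ) ^ 2 := by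
    have : lam ^ 2 = μ ^ 2 := (sq_abs lam).symm
    exact_mod_cast this
  have hab := abs_le.1 (le_refl |1 - μ|)
  have g₂ := hB₁.mono (c' := (1 - μ) / 2) (by linarith)
  have g₃ := hB₁.mono (c' := (μ - 1) / 2) (by linarith)
  have g₄ := hB₁.mono (c' := -(1 + μ) / 2) (by linarith)
  set G₁ : K →L[ℂ] K := (((1 + μ) / 2 : ℝ) : ℂ) • 1 - B with hG₁
  set G₂ : K →L[ℂ] K := B - (((1 - μ) / 2 : ℝ) : ℂ) • 1 with hG₂
  set G₃ : K →L[ℂ] K := B - (((μ - 1) / 2 : ℝ) : ℂ) • 1 with hG₃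
  set G₄ : K →L[ℂ] K := B - ((-(1 + μ) / 2 : ℝ) : ℂ) • 1 with hG₄
  have hfac : ((μ ^ 2 : ℝ) : ℂ) • (B * D * B) = G₁ * G₂ * (G₃ * G₄) := by
    have e1 : (16 : ℂ) • (((μ ^ 2 : ℝ) : ℂ) • (B * D * B)) =
        (16 * (μ : ℂ) ^ 2) • (B * B) - ((4 * lam : ℂ) • (B * a)) * ((4 * lam : ℂ) • (B * a)) := by
      have : B * D * B = B * B - (B * a) * (B * a) := by
        rw [hD]
        simp only [mul_sub, sub_mul, mul_one, mul_assoc]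
        rw [← haBc.eq]
      rw [this]
      simp only [smul_mul_assoc, mul_smul_comm, smul_smul]
      push_cast
      rw [← hsq]
      module
    have e2 : (16 : ℂ) • (((μ ^ 2 : ℝ) : ℂ) • (B * D * B)) =
        (16 : ℂ) • (G₁ * G₂ * (G₃ * G₄)) := by
      rw [e1, hBa, hsq, hG₁, hG₂, hG₃, hG₄]
      simp only [sub_mul, mul_sub, add_mul, mul_add, smul_mul_assoc, mul_smul_comm, one_mul,
        mul_one, mul_assoc, smul_add, smul_sub]
      push_cast
      module
    exact smul_right_injective _ (by norm_num : (16 : ℂ) ≠ 0) e2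
  have hcB : ∀ c : ℂ, Commute B (c • (1 : K →L[ℂ] K)) := fun c =>
    (Commute.one_right B).smul_right c
  have hGG : ∀ {c d : ℂ}, Commute (B - c • (1 : K →L[ℂ] K)) (B - d • 1) := fun {c d} =>
    ((Commute.refl B).sub_right (hcB d)).sub_left
      ((hcB c).symm.sub_right (((Commute.one_left _).smul_left c)))
  have hGG₁ : ∀ {c : ℂ}, Commute G₁ (B - c • (1 : K →L[ℂ] K)) := fun {c} => by
    rw [hG₁, ← neg_sub B]
    exact hGG.neg_left
  have nn := fun X : K →L[ℂ] K => ContinuousLinearMap.nonneg_iff_isPositive X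
  have hprod : 0 ≤ G₁ * G₂ * (G₃ * G₄) :=
    Commute.mul_nonneg (hGG₁.mul_nonneg ((nn _).2 hB₂.1) ((nn _).2 g₂.1))
      (hGG.mul_nonneg ((nn _).2 g₃.1) ((nn _).2 g₄.1))
      ((hGG₁.mul_right hGG₁).mul_left (hGG.mul_right hGG))
  have hDpos : D.IsPositive := by
    refine isPositive_of_conj_isPositive hB hBinj hDsa ?_
    have : B * D * B = (((μ ^ 2)⁻¹ : ℝ) : ℝ) • (G₁ * G₂ * (G₃ * G₄)) := by
      rw [← hfac, Complex.coe_smul, smul_smul, inv_mul_cancel₀ (by positivity), one_smul]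
    rw [this]
    exact (nn _).1 (smul_nonneg (by positivity) hprod)
  have hDinj : Function.Injective D := by
    rw [injective_iff_map_eq_zero]
    intro x hx
    have h0 : (G₁ * G₂ * (G₃ * G₄)) x = 0 := by
      rw [← hfac, mul_assoc, ← hDBc.eq]
      simp [hx]
    have inj : Function.Injective (G₁ * G₂ * (G₃ * G₄)) :=
      (hB₂.2.comp g₂.2).comp (g₃.2.comp g₄.2)
    exact (injective_iff_map_eq_zero _).1 inj x h0
  have hss : CFC.sqrt D * CFC.sqrt D = D := CFC.sqrt_mul_sqrt_self D ((nn _).2 hDpos)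
  refine ⟨a, CFC.sqrt D, hasa, (CFC.sqrt_nonneg D).isSelfAdjoint, ?_, haB,
    sqrt_mem_bicommutant hDB, by rw [hss, hD]; abel, hBa⟩
  rw [← hss] at hDinj
  exact Function.Injective.of_comp (f := ⇑(CFC.sqrt D)) hDinj

section Pencil

variable {H : Type*} [NormedAddCommGroup H] [InnerProductSpace ℂ H] [CompleteSpace H]

lemma isOrthoProj_of_reflection {U : H →L[ℂ] H} (hU : IsSelfAdjoint U) (hUU : U * U = 1) :
    IsOrthoProj ((1 / 2 : ℂ) • (1 + U)) := by
  refine ⟨IsSelfAdjoint.smul (by simp [IsSelfAdjoint]) ((IsSelfAdjoint.one _).add hU), ?_⟩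
  simp only [smul_mul_assoc, mul_smul_comm, add_mul, mul_add, hUU, one_mul, mul_one]
  module

/-- A reflection `U` solving the pencil equation yields a pair of projections. -/
lemma mem_pencilPairs_of_reflection {lam : ℝ} {S U : H →L[ℂ] H} (hS : IsSelfAdjoint S)
    (hU : IsSelfAdjoint U) (hUU : U * U = 1)
    (hSU : (2 * lam : ℂ) • (S * U + U * S) = (4 : ℂ) • (S * S) + ((lam : ℂ) ^ 2 - 1) • 1) :
    ((1 / 2 : ℂ) • (1 + U), (1 / 2 : ℂ) • (1 + ((2 : ℂ) • S - (lam : ℂ) • U))) ∈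
      pencilPairs lam (S + (((1 + lam) / 2 : ℝ) : ℂ) • 1) := by
  refine ⟨isOrthoProj_of_reflection hU hUU, isOrthoProj_of_reflection ?_ ?_, ?_⟩
  · exact (IsSelfAdjoint.smul (by simp [IsSelfAdjoint]) hS).sub
      (IsSelfAdjoint.smul (Complex.conj_ofReal _) hU)
  · simp only [sub_mul, mul_sub, smul_mul_assoc, mul_smul_comm, hUU]
    linear_combination (norm := module) (-1 : ℂ) • hSU
  · push_cast
    module

/-- Both projections of a pencil pair commute with the square of the centred operator. -/
lemma commute_mul_self_of_mem_pencilPairs {lam : ℝ} (hlam : lam ≠ 0) {S P Q : H →L[ℂ] H}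
    (h : (P, Q) ∈ pencilPairs lam (S + (((1 + lam) / 2 : ℝ) : ℂ) • 1)) :
    Commute (S * S) P ∧ Commute (S * S) Q := by
  obtain ⟨⟨-, hP⟩, ⟨-, hQ⟩, hT⟩ := h
  dsimp only at hP hQ hT
  have hl : (lam : ℂ) ≠ 0 := by exact_mod_cast hlam
  have hQe : Q = S + (((1 + lam) / 2 : ℝ) : ℂ) • 1 - (lam : ℂ) • P := by rw [hT]; abel
  have key : (lam : ℂ) • (S * P + P * S) =
      S * S + (lam : ℂ) • S + (((lam : ℂ) ^ 2 - 1) / 4) • 1 := by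
    rw [hQe] at hQ
    simp only [sub_mul, mul_sub, add_mul, mul_add, smul_mul_assoc, mul_smul_comm, hP,
      one_mul, mul_one] at hQ
    push_cast at hQ
    linear_combination (norm := module) (-1 : ℂ) • hQ
  have hc : Commute S ((lam : ℂ) • (S * P + P * S)) := by
    rw [key]
    exact (((Commute.refl S).mul_right (.refl S)).add_right ((Commute.refl S).smul_right _)).add_right
      ((Commute.one_right S).smul_right _)
  have hc' : Commute S (S * P + P * S) := by
    have := hc.smul_right (lam : ℂ)⁻¹
    rwa [smul_smul, inv_mul_cancel₀ hl, one_smul] at this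
  have hSP : Commute (S * S) P := by
    have := hc'.eq
    simp only [mul_add, add_mul, mul_assoc] at this
    rw [Commute, SemiconjBy, mul_assoc, ← add_left_inj (S * (P * S)), this]
    exact add_comm _ _
  refine ⟨hSP, ?_⟩
  rw [hQe]
  exact ((((Commute.refl S).mul_left (.refl S))).add_right
    ((Commute.one_right _).smul_right _)).sub_right (hSP.smul_right _)

end Pencil

section Blocks

variable {K : Type*} [NormedAddCommGroup K] [InnerProductSpace ℂ K]

omit [NormedAddCommGroup K] [InnerProductSpace ℂ K] in
lemma withLp_prod_ext {x y : WithLp 2 (K × K)} (h₁ : x.fst = y.fst) (h₂ : x.snd = y.snd) :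
    x = y :=
  WithLp.ofLp_injective 2 (Prod.ext h₁ h₂)

lemma blk_apply_fst (A B C D : K →L[ℂ] K) (x : WithLp 2 (K × K)) :
    (blk A B C D x).fst = A x.fst + B x.snd := rfl

lemma blk_apply_snd (A B C D : K →L[ℂ] K) (x : WithLp 2 (K × K)) :
    (blk A B C D x).snd = C x.fst + D x.snd := rfl

lemma blk_mul (A B C D A' B' C' D' : K →L[ℂ] K) :
    blk A B C D * blk A' B' C' D' =
      blk (A * A' + B * C') (A * B' + B * D') (C * A' + D * C') (C * B' + D * D') := by
  ext x
  apply withLp_prod_ext <;> simp [blk_apply_fst, blk_apply_snd] <;> abel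

lemma blk_add (A B C D A' B' C' D' : K →L[ℂ] K) :
    blk A B C D + blk A' B' C' D' = blk (A + A') (B + B') (C + C') (D + D') := by
  ext x
  apply withLp_prod_ext <;> simp [blk_apply_fst, blk_apply_snd] <;> abel

lemma smul_blk (c : ℂ) (A B C D : K →L[ℂ] K) :
    c • blk A B C D = blk (c • A) (c • B) (c • C) (c • D) := by
  ext x
  apply withLp_prod_ext <;> simp [blk_apply_fst, blk_apply_snd]

lemma one_eq_blk : (1 : WithLp 2 (K × K) →L[ℂ] WithLp 2 (K × K)) = blk 1 0 0 1 := by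
  ext x
  apply withLp_prod_ext <;> simp [blk_apply_fst, blk_apply_snd]

lemma blk_inj {A B C D A' B' C' D' : K →L[ℂ] K} :
    blk A B C D = blk A' B' C' D' ↔ A = A' ∧ B = B' ∧ C = C' ∧ D = D' := by
  refine ⟨fun h => ?_, by rintro ⟨rfl, rfl, rfl, rfl⟩; rfl⟩
  have h₁ := fun x => congrArg WithLp.fst (DFunLike.congr_fun h x)
  have h₂ := fun x => congrArg WithLp.snd (DFunLike.congr_fun h x)
  simp only [blk_apply_fst, blk_apply_snd] at h₁ h₂
  refine ⟨?_, ?_, ?_, ?_⟩ <;> ext x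
  · simpa using h₁ (WithLp.toLp 2 (x, 0))
  · simpa using h₁ (WithLp.toLp 2 (0, x))
  · simpa using h₂ (WithLp.toLp 2 (x, 0))
  · simpa using h₂ (WithLp.toLp 2 (0, x))

lemma exists_eq_blk (M : WithLp 2 (K × K) →L[ℂ] WithLp 2 (K × K)) :
    ∃ A B C D : K →L[ℂ] K, M = blk A B C D := by
  let e := WithLp.prodContinuousLinearEquiv 2 ℂ K K
  let N : K × K →L[ℂ] K × K := (e : WithLp 2 (K × K) →L[ℂ] K × K) ∘L M ∘L
    (e.symm : K × K →L[ℂ] WithLp 2 (K × K))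
  let l := ContinuousLinearMap.inl ℂ K K
  let r := ContinuousLinearMap.inr ℂ K K
  let p := ContinuousLinearMap.fst ℂ K K
  let q := ContinuousLinearMap.snd ℂ K K
  refine ⟨p ∘L N ∘L l, p ∘L N ∘L r, q ∘L N ∘L l, q ∘L N ∘L r, ?_⟩
  have key : ∀ x : WithLp 2 (K × K),
      M x = M (WithLp.toLp 2 (x.fst, 0)) + M (WithLp.toLp 2 (0, x.snd)) := fun x => by
    rw [← map_add]
    congr 1
    apply withLp_prod_ext <;> simp
  ext x
  apply withLp_prod_ext
  · exact congrArg WithLp.fst (key x)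
  · exact congrArg WithLp.snd (key x)

lemma star_blk [CompleteSpace K] (A B C D : K →L[ℂ] K) :
    star (blk A B C D) = blk (star A) (star C) (star B) (star D) := by
  rw [ContinuousLinearMap.star_eq_adjoint, eq_comm, ContinuousLinearMap.eq_adjoint_iff]
  intro x y
  have inner_eq : ∀ u v : WithLp 2 (K × K),
      inner ℂ u v = inner ℂ u.fst v.fst + inner ℂ u.snd v.snd := fun _ _ => rfl
  simp only [inner_eq, blk_apply_fst, blk_apply_snd, ContinuousLinearMap.star_eq_adjoint,
    inner_add_left, inner_add_right, ContinuousLinearMap.adjoint_inner_left]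
  ring

lemma commute_diagonal_blk_iff {A B C D E : K →L[ℂ] K} :
    Commute (blk E 0 0 E) (blk A B C D) ↔
      Commute E A ∧ Commute E B ∧ Commute E C ∧ Commute E D := by
  simp [Commute, SemiconjBy, blk_mul, blk_inj]

end Blocks

/-- The reflection with entries `a`, `W s` gives a pair of projections in the pencil. -/
lemma blk_mem_pencilPairs {lam : ℝ} {B a s W : K →L[ℂ] K} (hB : IsSelfAdjoint B)
    (ha : IsSelfAdjoint a) (hs : IsSelfAdjoint s)
    (haB : a ∈ Set.centralizer (Set.centralizer {B}))
    (hsB : s ∈ Set.centralizer (Set.centralizer {B}))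
    (has : a * a + s * s = 1)
    (hBa : (4 * lam : ℂ) • (B * a) = (4 : ℂ) • (B * B) + ((lam : ℂ) ^ 2 - 1) • 1)
    (hW : W ∈ unitary (K →L[ℂ] K)) (hBW : Commute B W) :
    ((1 / 2 : ℂ) • (1 + blk a (W * s) (s * star W) (-a)),
      (1 / 2 : ℂ) • (1 + ((2 : ℂ) • blk B 0 0 (-B) -
        (lam : ℂ) • blk a (W * s) (s * star W) (-a)))) ∈
      pencilPairs lam (blk B 0 0 (-B) + (((1 + lam) / 2 : ℝ) : ℂ) • 1) := by
  have hBW' : Commute B (star W) := by simpa [hB.star_eq] using hBW.star_star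
  rw [mem_bicommutant_singleton] at haB hsB
  have haBc : Commute B a := haB B (.refl B)
  have hsBc : Commute B s := hsB B (.refl B)
  have hsa : Commute s a := haB s hsBc
  have hWa : Commute W a := haB W hBW
  have hWa' : Commute (star W) a := haB _ hBW'
  have hWs : Commute W s := hsB W hBW
  obtain ⟨hW₁, hW₂⟩ := Unitary.mem_iff.1 hW
  refine mem_pencilPairs_of_reflection ?_ ?_ ?_ ?_
  · rw [IsSelfAdjoint, star_blk, star_neg, hB.star_eq, star_zero]
  · rw [IsSelfAdjoint, star_blk]
    simp [hs.star_eq, ha.star_eq]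
  · rw [blk_mul, one_eq_blk, blk_inj]
    refine ⟨?_, ?_, ?_, ?_⟩
    · rw [← has, show W * s * (s * star W) = s * s * (W * star W) by
        rw [hWs.eq, mul_assoc s W, ← mul_assoc W s, hWs.eq]; simp only [mul_assoc], hW₂, mul_one]
    · rw [mul_neg, (hWa.mul_left hsa).eq, add_neg_cancel]
    · rw [neg_mul, (hsa.mul_left hWa').eq, add_neg_cancel]
    · rw [neg_mul_neg, ← has, show s * star W * (W * s) = s * (star W * W) * s by
        simp only [mul_assoc], hW₁, mul_one, add_comm]
  · rw [blk_mul, blk_mul, blk_mul, blk_add, smul_blk, smul_blk, one_eq_blk, smul_blk, blk_add,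
      blk_inj]
    have hd : (2 * lam : ℂ) • (B * a + a * B) = (4 : ℂ) • (B * B) + ((lam : ℂ) ^ 2 - 1) • 1 := by
      rw [← hBa, ← haBc.eq]
      module
    refine ⟨?_, ?_, ?_, ?_⟩
    · simpa using hd
    · simp [(hBW.mul_right hsBc).eq]
    · simp [(hsBc.mul_right hBW').eq]
    · simpa using hd

/-- An operator anticommuting with an injective positive operator vanishes. -/
lemma eq_zero_of_mul_eq_neg_mul {B y : K →L[ℂ] K} (hBpos : B.IsPositive)
    (hBinj : Function.Injective B) (h : B * y = -(y * B)) : y = 0 := by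
  have hsq : Commute (B * B) y := by
    rw [Commute, SemiconjBy, mul_assoc, h, mul_neg, ← mul_assoc, h, neg_mul, neg_neg, mul_assoc]
  have hc : Commute B y :=
    commute_of_commute_mul_self ((ContinuousLinearMap.nonneg_iff_isPositive _).2 hBpos) hsq
  have h2 : (2 : ℂ) • (B * y) = 0 := by
    rw [two_smul]
    exact eq_neg_iff_add_eq_zero.1 (h.trans (congrArg _ hc.eq.symm))
  have h0 : B * y = 0 := (smul_eq_zero.1 h2).resolve_left two_ne_zero
  ext x
  exact hBinj (by simpa using DFunLike.congr_fun h0 x)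

omit [CompleteSpace K] in
lemma eq_of_injective_of_mul_eq {s x y : K →L[ℂ] K} (hs : Function.Injective s)
    (h : s * x = s * y) : x = y := by
  ext z
  exact hs (DFunLike.congr_fun h z)

/-- The commutant of the projections in the pencil. -/
lemma centralizer_pencilGens {lam : ℝ} (hlam : lam ≠ -1 ∧ lam ≠ 0)
    {B : K →L[ℂ] K} (hBpos : B.IsPositive)
    (hB₁ : OpLt (((abs (1 - |lam|) / 2 : ℝ) : ℂ) • (1 : K →L[ℂ] K)) B)
    (hB₂ : OpLt B ((((1 + |lam|) / 2 : ℝ) : ℂ) • (1 : K →L[ℂ] K))) :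
    (pencilGens lam (blk B 0 0 (-B) + (((1 + lam) / 2 : ℝ) : ℂ) • 1)).centralizer =
      {M : WithLp 2 (K × K) →L[ℂ] WithLp 2 (K × K) |
        ∃ A ∈ Set.centralizer (Set.centralizer {B}), M = blk A 0 0 A} := by
  have hB := hBpos.isSelfAdjoint
  have hBinj : Function.Injective B := by
    have := (hB₁.mono (c' := 0) (by positivity)).2
    rwa [Complex.ofReal_zero, zero_smul, sub_zero] at this
  have hB0 : 0 ≤ B := (ContinuousLinearMap.nonneg_iff_isPositive _).2 hBpos
  ext X
  constructor
  · intro hX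
    rw [Set.mem_centralizer_iff] at hX
    obtain ⟨a, s, ha, hs, hsinj, haB, hsB, has, hBa⟩ :=
      exists_reflection_entries hlam hBpos hBinj hB₁ hB₂
    have hpair := fun W hW hBW => blk_mem_pencilPairs (W := W) hB ha hs haB hsB has hBa hW hBW
    have of_half : ∀ {Y : WithLp 2 (K × K) →L[ℂ] WithLp 2 (K × K)},
        Commute ((1 / 2 : ℂ) • (1 + Y)) X → Commute Y X := fun {Y} h => by
      have := (h.smul_left (2 : ℂ)).sub_left (Commute.one_left X)
      rwa [smul_smul, mul_one_div_cancel two_ne_zero, one_smul, add_sub_cancel_left] at this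
    have hU : ∀ W ∈ unitary (K →L[ℂ] K), Commute B W →
        Commute (blk a (W * s) (s * star W) (-a)) X := fun W hW hBW =>
      of_half (hX _ (Or.inl ⟨_, hpair W hW hBW, rfl⟩))
    have hS : Commute (blk B 0 0 (-B)) X := by
      have h1 := of_half (hX _ (Or.inr ⟨_, hpair 1 (one_mem _) (.one_right B), rfl⟩))
      have h2 := (h1.add_left ((hU 1 (one_mem _) (.one_right B)).smul_left (lam : ℂ))).smul_left
        (2 : ℂ)⁻¹
      rwa [sub_add_cancel, smul_smul, inv_mul_cancel₀ two_ne_zero, one_smul] at h2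
    obtain ⟨x, y, z, w, rfl⟩ := exists_eq_blk X
    rw [Commute, SemiconjBy, blk_mul, blk_mul, blk_inj] at hS
    simp only [zero_mul, mul_zero, add_zero, zero_add, mul_neg, neg_mul] at hS
    obtain ⟨hx, hy, hz, -⟩ := hS
    obtain rfl := eq_zero_of_mul_eq_neg_mul hBpos hBinj hy
    obtain rfl := eq_zero_of_mul_eq_neg_mul hBpos hBinj (neg_eq_iff_eq_neg.1 hz)
    have hUW : ∀ W ∈ unitary (K →L[ℂ] K), Commute B W → W * s * w = x * (W * s) := by
      intro W hW hBW
      have h := hU W hW hBW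
      rw [Commute, SemiconjBy, blk_mul, blk_mul, blk_inj] at h
      simpa using h.2.1
    rw [mem_bicommutant_singleton] at hsB
    have hxs : Commute x s := hsB x hx
    obtain rfl : w = x := eq_of_injective_of_mul_eq hsinj (by
      simpa [hxs.eq] using hUW 1 (one_mem _) (.one_right B))
    refine ⟨w, mem_bicommutant_of_commute_unitary hB fun W hW hBW => ?_, rfl⟩
    refine eq_of_injective_of_mul_eq hsinj ?_
    have h := hUW W hW hBW
    have hWs : Commute W s := hsB W hBW
    calc s * (w * W) = w * (W * s) := by rw [hWs.eq, ← mul_assoc, ← mul_assoc, hxs.eq]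
      _ = s * (W * w) := by rw [← h, hWs.eq, mul_assoc]
  · rintro ⟨A, hA, rfl⟩
    rw [mem_bicommutant_singleton] at hA
    have hcomm : ∀ Y : WithLp 2 (K × K) →L[ℂ] WithLp 2 (K × K),
        Commute (blk B 0 0 (-B) * blk B 0 0 (-B)) Y → Commute Y (blk A 0 0 A) := by
      intro Y hY
      obtain ⟨p, q, r, t, rfl⟩ := exists_eq_blk Y
      have hsq : blk B 0 0 (-B) * blk B 0 0 (-B) = blk (B * B) 0 0 (B * B) := by
        simp [blk_mul]
      rw [hsq, commute_diagonal_blk_iff] at hY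
      refine (commute_diagonal_blk_iff.2 ⟨?_, ?_, ?_, ?_⟩).symm
      exacts [(hA _ (commute_of_commute_mul_self hB0 hY.1)).symm,
        (hA _ (commute_of_commute_mul_self hB0 hY.2.1)).symm,
        (hA _ (commute_of_commute_mul_self hB0 hY.2.2.1)).symm,
        (hA _ (commute_of_commute_mul_self hB0 hY.2.2.2)).symm]
    rintro Y (⟨⟨P, Q⟩, hPQ, rfl⟩ | ⟨⟨P, Q⟩, hPQ, rfl⟩)
    · exact hcomm _ (commute_mul_self_of_mem_pencilPairs hlam.2 hPQ).1
    · exact hcomm _ (commute_mul_self_of_mem_pencilPairs hlam.2 hPQ).2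

omit [CompleteSpace K] in
/-- The operators commuting with `A ⊕ A` for all `A ∈ S` are the block operators with entries
commuting with `S`. -/
lemma centralizer_diagonal_blk (S : Set (K →L[ℂ] K)) :
    Set.centralizer {M : WithLp 2 (K × K) →L[ℂ] WithLp 2 (K × K) | ∃ A ∈ S, M = blk A 0 0 A} =
      {M | ∃ A₁₁ ∈ S.centralizer, ∃ A₁₂ ∈ S.centralizer, ∃ A₂₁ ∈ S.centralizer,
        ∃ A₂₂ ∈ S.centralizer, M = blk A₁₁ A₁₂ A₂₁ A₂₂} := by
  ext M
  constructor
  · intro hM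
    obtain ⟨p, q, r, t, rfl⟩ := exists_eq_blk M
    have h := fun A hA => commute_diagonal_blk_iff.1 (hM (blk A 0 0 A) ⟨A, hA, rfl⟩)
    exact ⟨p, fun A hA => (h A hA).1, q, fun A hA => (h A hA).2.1,
      r, fun A hA => (h A hA).2.2.1, t, fun A hA => (h A hA).2.2.2, rfl⟩
  · rintro ⟨p, hp, q, hq, r, hr, t, ht, rfl⟩ _ ⟨A, hA, rfl⟩
    exact commute_diagonal_blk_iff.2 ⟨hp A hA, hq A hA, hr A hA, ht A hA⟩

/-- For `λ ∈ ℝ \ {−1, 0}` and `T = (B ⊕ (−B)) + ((1+λ)/2)·I` with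
`(|1−|λ||/2)·I < B < ((1+|λ|)/2)·I`, the von Neumann algebra generated by the projections
occurring in `𝒯_λ` (i.e. the double commutant of that family) is `M₂({B}')` — the set of
block operators whose four entries commute with `B` — and its commutant is
`{A ⊕ A : A ∈ {B}''}`. -/
theorem pencil_vonNeumann_algebra (lam : ℝ) (hlam : lam ≠ -1 ∧ lam ≠ 0)
    (B : K →L[ℂ] K) (hBpos : B.IsPositive)
    (hB₁ : OpLt (((abs (1 - |lam|) / 2 : ℝ) : ℂ) • (1 : K →L[ℂ] K)) B)
    (hB₂ : OpLt B ((((1 + |lam|) / 2 : ℝ) : ℂ) • (1 : K →L[ℂ] K)))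
    (T : WithLp 2 (K × K) →L[ℂ] WithLp 2 (K × K))
    (hT : T = blk B 0 0 (-B) + (((1 + lam) / 2 : ℝ) : ℂ) • 1) :
    (pencilGens lam T).centralizer.centralizer =
      {M : WithLp 2 (K × K) →L[ℂ] WithLp 2 (K × K) |
        ∃ A₁₁ ∈ Set.centralizer {B}, ∃ A₁₂ ∈ Set.centralizer {B},
        ∃ A₂₁ ∈ Set.centralizer {B}, ∃ A₂₂ ∈ Set.centralizer {B},
          M = blk A₁₁ A₁₂ A₂₁ A₂₂} ∧
    ((pencilGens lam T).centralizer.centralizer).centralizer =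
      {M : WithLp 2 (K × K) →L[ℂ] WithLp 2 (K × K) |
        ∃ A ∈ Set.centralizer (Set.centralizer {B}), M = blk A 0 0 A} := by
  subst hT
  have h := centralizer_pencilGens hlam hBpos hB₁ hB₂
  refine ⟨?_, ?_⟩
  · rw [h, centralizer_diagonal_blk, Set.centralizer_centralizer_centralizer]
  · rw [Set.centralizer_centralizer_centralizer, h]
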